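/- Both atomic decompositions preserve termination of the oblivious and semi-oblivious chase: for X ∈ {O, SO}, if a rule set 𝓡 is in CT_X^∀ then both 1ad(𝓡) and 2ad(𝓡) are in CT_X^∀. -/

import Mathlib

namespace ExRules

open scoped Classical

noncomputable section

/-- Terms: constants or variables, each indexed by a natural number. -/
inductive Term where
  | const : ℕ → Term
  | var : ℕ → Term
deriving DecidableEq

/-- An atom: a predicate symbol applied to a list of terms (the arity of the
predicate is the length of the argument list). -/
structure Atom where
  pred : ℕ
  args : List Term
deriving DecidableEq

/-- A factbase is a finite set of atoms. -/
abbrev FactBase := Finset Atom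

/-- A substitution: a map on variables (extended by the identity on constants). -/
abbrev Subst := ℕ → Term

def applyTerm (σ : Subst) : Term → Term
  | .const c => .const c
  | .var v => σ v

def Atom.subst (σ : Subst) (a : Atom) : Atom := ⟨a.pred, a.args.map (applyTerm σ)⟩

def Term.vars : Term → Finset ℕ
  | .const _ => ∅
  | .var v => {v}

def Atom.vars (a : Atom) : Finset ℕ := a.args.foldr (fun t s => t.vars ∪ s) ∅

def FactBase.vars (F : FactBase) : Finset ℕ := F.sup Atom.vars

/-- The variables occurring in a (possibly infinite) set of atoms. -/
def setVars (S : Set Atom) : Set ℕ := {v | ∃ a ∈ S, v ∈ a.vars}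

/-- `σ` is a homomorphism from the atom set `S` to the atom set `S'`. -/
def IsHom (σ : Subst) (S S' : Set Atom) : Prop := ∀ a ∈ S, a.subst σ ∈ S'

/-- A retraction is a homomorphism that is the identity on the common variables. -/
def IsRetraction (σ : Subst) (S S' : Set Atom) : Prop :=
  IsHom σ S S' ∧ ∀ v, v ∈ setVars S → v ∈ setVars S' → σ v = Term.var v

/-- An existential rule `B → ∃z.H` with nonempty body and head.  The frontier and
the existential variables are determined by the variables shared between body and
head. -/
structure Rule where
  body : Finset Atom
  head : Finset Atom
  body_nonempty : body.Nonempty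
  head_nonempty : head.Nonempty

instance : DecidableEq Rule := fun R S =>
  decidable_of_iff (R.body = S.body ∧ R.head = S.head) (by
    constructor
    · rintro ⟨h1, h2⟩
      cases R; cases S; simp_all
    · rintro rfl; exact ⟨rfl, rfl⟩)

/-- The frontier of a rule: the variables shared by body and head. -/
def Rule.frontier (R : Rule) : Finset ℕ := FactBase.vars R.body ∩ FactBase.vars R.head

/-- The existential variables of a rule: head variables not occurring in the body. -/
def Rule.exVars (R : Rule) : Finset ℕ := FactBase.vars R.head \ FactBase.vars R.body

/-- A rule is Datalog if it has no existential variable. -/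
def Rule.IsDatalog (R : Rule) : Prop := R.exVars = ∅

/-- A rule has an atomic head if its head is a single atom. -/
def Rule.IsAtomicHead (R : Rule) : Prop := R.head.card = 1

/-- A rule set is a finite set of existential rules. -/
abbrev RuleSet := Finset Rule

instance : Encodable Term :=
  Encodable.ofEquiv (ℕ ⊕ ℕ)
    { toFun := fun t => match t with | .const c => .inl c | .var v => .inr v
      invFun := fun s => match s with | .inl c => .const c | .inr v => .var v
      left_inv := by intro t; cases t <;> rfl
      right_inv := by intro s; cases s <;> rfl }

instance : Encodable Atom :=
  Encodable.ofEquiv (ℕ × List Term)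
    { toFun := fun a => (a.pred, a.args)
      invFun := fun p => ⟨p.1, p.2⟩
      left_inv := fun _ => rfl
      right_inv := fun _ => rfl }

instance : Encodable Rule :=
  Encodable.ofEquiv {p : Finset Atom × Finset Atom // p.1.Nonempty ∧ p.2.Nonempty}
    { toFun := fun R => ⟨(R.body, R.head), R.body_nonempty, R.head_nonempty⟩
      invFun := fun p => ⟨p.1.1, p.1.2, p.2.1, p.2.2⟩
      left_inv := fun _ => rfl
      right_inv := fun _ => rfl }

/-- A trigger `(R, π)`: a rule together with a substitution. -/
structure Trigger where
  rule : Rule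
  map : Subst

/-- The canonical fresh variable `z_t` associated to a trigger `t` and an
existential variable `z`: it is unique for `z` and (the relevant part of) `t`. -/
def Trigger.freshVar (t : Trigger) (z : ℕ) : ℕ :=
  Nat.pair
    (Encodable.encode (t.rule, ((FactBase.vars t.rule.body).sort (· ≤ ·)).map t.map)) z

/-- The extension `π_R` of the substitution of a trigger, mapping each existential
variable `z` to the fresh variable `z_t`. -/
def Trigger.ext (t : Trigger) : Subst := fun v =>
  if v ∈ t.rule.exVars then Term.var (t.freshVar v) else t.map v

/-- The output of a trigger: `out(t) = π_R(H)`. -/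
def Trigger.out (t : Trigger) : Finset Atom := t.rule.head.image (Atom.subst t.ext)

/-- `t` is a trigger on the factbase `F`: its substitution is a homomorphism from
the body of its rule to `F`. -/
def Trigger.IsOn (t : Trigger) (F : FactBase) : Prop := IsHom t.map ↑t.rule.body ↑F

/-- The chase variants: oblivious, semi-oblivious, restricted, equivalent. -/
inductive Variant where
  | O | SO | R | E

/-- Applicability of a trigger on a factbase, for each chase variant. -/
def Applicable : Variant → Trigger → FactBase → Prop
  | .O, t, F => ¬ t.out ⊆ F
  | .SO, t, F => ∀ t' : Trigger, t'.rule = t.rule →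
      (∀ v ∈ t.rule.frontier, t'.map v = t.map v) → ¬ t'.out ⊆ F
  | .R, t, F => ¬ ∃ σ : Subst, IsRetraction σ ↑(F ∪ t.out) ↑F
  | .E, t, F => ¬ ∃ σ : Subst, IsHom σ ↑(F ∪ t.out) ↑F

/-- An atom set `M` satisfies a rule `B → ∃z.H` if every homomorphism from `B`
to `M` extends to a homomorphism mapping `H` into `M`. -/
def SatisfiesRule (M : Set Atom) (R : Rule) : Prop :=
  ∀ σ : Subst, IsHom σ ↑R.body M →
    ∃ σ' : Subst, (∀ v ∈ FactBase.vars R.body, σ' v = σ v) ∧ IsHom σ' ↑R.head M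

/-- A (finite or infinite) derivation from the knowledge base `⟨𝓡, F⟩`:
`len` is the number of triggers (possibly `⊤`), `fb i` is the `i`-th factbase and,
for `i < len`, `tr i` is the trigger producing `fb (i+1)` from `fb i`. -/
structure Derivation (𝓡 : RuleSet) (F : FactBase) where
  len : ℕ∞
  fb : ℕ → FactBase
  tr : ℕ → Trigger
  fb_zero : fb 0 = F
  rule_mem : ∀ i : ℕ, (i : ℕ∞) < len → (tr i).rule ∈ 𝓡
  trig_on : ∀ i : ℕ, (i : ℕ∞) < len → (tr i).IsOn (fb i)
  trig_new : ∀ i : ℕ, (i : ℕ∞) < len → ¬ (tr i).out ⊆ fb i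
  fb_succ : ∀ i : ℕ, (i : ℕ∞) < len → fb (i + 1) = fb i ∪ (tr i).out
  fb_stall : ∀ i : ℕ, ¬ (i : ℕ∞) < len → fb (i + 1) = fb i

namespace Derivation

variable {𝓡 : RuleSet} {F : FactBase}

/-- An `X`-derivation: every applied trigger is `X`-applicable when applied. -/
def IsX (X : Variant) (D : Derivation 𝓡 F) : Prop :=
  ∀ i : ℕ, (i : ℕ∞) < D.len → Applicable X (D.tr i) (D.fb i)

/-- Datalog-first: a non-Datalog rule is only applied when all Datalog rules of
the rule set are satisfied. -/
def DatalogFirst (D : Derivation 𝓡 F) : Prop :=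
  ∀ i : ℕ, (i : ℕ∞) < D.len → ¬ (D.tr i).rule.IsDatalog →
    ∀ R ∈ 𝓡, R.IsDatalog → SatisfiesRule ↑(D.fb i) R

/-- Fairness: every trigger `X`-applicable on some factbase of the derivation is
eventually not `X`-applicable. -/
def Fair (X : Variant) (D : Derivation 𝓡 F) : Prop :=
  ∀ i : ℕ, (i : ℕ∞) ≤ D.len → ∀ t : Trigger, t.rule ∈ 𝓡 → t.IsOn (D.fb i) →
    Applicable X t (D.fb i) →
    ∃ j : ℕ, i < j ∧ (j : ℕ∞) ≤ D.len ∧ ¬ Applicable X t (D.fb j)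

/-- A derivation is finite if its length is not `⊤`. -/
def Finite (D : Derivation 𝓡 F) : Prop := D.len ≠ ⊤

end Derivation

/-- `CT_X^∀` (non-Datalog-first): every fair `X`-derivation from every KB is finite. -/
def CTall (X : Variant) (𝓡 : RuleSet) : Prop :=
  ∀ F : FactBase, ∀ D : Derivation 𝓡 F, D.IsX X → D.Fair X → D.Finite

/-- `CT_X^∃`: some fair `X`-derivation from every KB is finite. -/
def CTex (X : Variant) (𝓡 : RuleSet) : Prop :=
  ∀ F : FactBase, ∃ D : Derivation 𝓡 F, D.IsX X ∧ D.Fair X ∧ D.Finite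

/-- `CT_{df-X}^∀`: every fair Datalog-first `X`-derivation from every KB is finite. -/
def CTallDF (X : Variant) (𝓡 : RuleSet) : Prop :=
  ∀ F : FactBase, ∀ D : Derivation 𝓡 F, D.IsX X → D.DatalogFirst → D.Fair X → D.Finite

/-- `CT_{df-X}^∃`: some fair Datalog-first `X`-derivation from every KB is finite. -/
def CTexDF (X : Variant) (𝓡 : RuleSet) : Prop :=
  ∀ F : FactBase, ∃ D : Derivation 𝓡 F, D.IsX X ∧ D.DatalogFirst ∧ D.Fair X ∧ D.Finite

/-! ### Single-piece decomposition -/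

/-- Adjacency in the piece graph of a rule: two head atoms sharing an existential
variable. -/
def PieceAdj (R : Rule) (a b : Atom) : Prop :=
  a ∈ R.head ∧ b ∈ R.head ∧ (a.vars ∩ b.vars ∩ R.exVars).Nonempty

/-- The piece (connected component of the piece graph) containing a given head atom. -/
def pieceOf (R : Rule) (a : Atom) : Finset Atom :=
  R.head.filter fun b => Relation.ReflTransGen (PieceAdj R) a b

theorem self_mem_pieceOf {R : Rule} {a : Atom} (h : a ∈ R.head) : a ∈ pieceOf R a := by
  rw [pieceOf, Finset.mem_filter]
  exact ⟨h, Relation.ReflTransGen.refl⟩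

/-- The single-piece decomposition of a rule. -/
def Rule.sp (R : Rule) : Finset Rule :=
  R.head.attach.image fun a =>
    ⟨R.body, pieceOf R a.1, R.body_nonempty, ⟨a.1, self_mem_pieceOf a.2⟩⟩

/-- The single-piece decomposition of a rule set. -/
def spSet (𝓡 : RuleSet) : RuleSet := 𝓡.biUnion Rule.sp

/-! ### Atomic decompositions -/

/-- The predicates occurring in a rule set. -/
def RuleSet.predsF (𝓡 : RuleSet) : Finset ℕ :=
  𝓡.sup fun R => (R.body.image Atom.pred) ∪ (R.head.image Atom.pred)

/-- A fresh predicate `X_R`, unique for `R` and not occurring in `𝓡`. -/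
def freshPred (𝓡 : RuleSet) (R : Rule) : ℕ :=
  (RuleSet.predsF 𝓡).sup id + 1 + Encodable.encode R

/-- The atom `X_R(x, z)` over the fresh predicate, whose arguments are the frontier
variables followed by the existential variables of `R`. -/
def xAtom (𝓡 : RuleSet) (R : Rule) : Atom :=
  ⟨freshPred 𝓡 R,
    ((R.frontier.sort (· ≤ ·)).map Term.var) ++ ((R.exVars.sort (· ≤ ·)).map Term.var)⟩

/-- The one-way atomic decomposition of a rule `R = B → ∃z.H` (relative to `𝓡`):
the rule `B → ∃z.X_R(x,z)` together with a rule `X_R(x,z) → P(t)` for each head atom. -/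
def oneAdRule (𝓡 : RuleSet) (R : Rule) : Finset Rule :=
  insert ⟨R.body, {xAtom 𝓡 R}, R.body_nonempty, Finset.singleton_nonempty _⟩
    (R.head.attach.image fun a =>
      ⟨{xAtom 𝓡 R}, {a.1}, Finset.singleton_nonempty _, Finset.singleton_nonempty _⟩)

/-- The one-way atomic decomposition of a rule set. -/
def oneAd (𝓡 : RuleSet) : RuleSet := 𝓡.biUnion (oneAdRule 𝓡)

/-- The two-way atomic decomposition: `2ad(R) = 1ad(R) ∪ {H[x,z] → X_R(x,z)}`. -/
def twoAd (𝓡 : RuleSet) : RuleSet :=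
  oneAd 𝓡 ∪ 𝓡.image fun R =>
    ⟨R.head, {xAtom 𝓡 R}, R.head_nonempty, Finset.singleton_nonempty _⟩

/-! ### Models, entailment, BDDP -/

/-- `M` is a model of the rule set `𝓡`. -/
def IsModelOfRules (𝓡 : RuleSet) (M : Set Atom) : Prop := ∀ R ∈ 𝓡, SatisfiesRule M R

/-- `M` is a model of the knowledge base `⟨𝓡, F⟩`. -/
def IsModelOfKB (𝓡 : RuleSet) (F : FactBase) (M : Set Atom) : Prop :=
  IsModelOfRules 𝓡 M ∧ ∃ σ : Subst, IsHom σ ↑F M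

/-- `M` is a universal model of `⟨𝓡, F⟩`: a model mapping homomorphically into
every model. -/
def IsUniversalModel (𝓡 : RuleSet) (F : FactBase) (M : Set Atom) : Prop :=
  IsModelOfKB 𝓡 F M ∧ ∀ N : Set Atom, IsModelOfKB 𝓡 F N → ∃ σ : Subst, IsHom σ M N

/-- An atom set entails a Boolean conjunctive query `Q` if `Q` maps
homomorphically into it. -/
def EntailsQ (S : Set Atom) (Q : Finset Atom) : Prop := ∃ σ : Subst, IsHom σ ↑Q S

/-- `⟨𝓡, F⟩ ⊨ Q`: every model of the KB entails `Q`. -/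
def KBEntails (𝓡 : RuleSet) (F : FactBase) (Q : Finset Atom) : Prop :=
  ∀ M : Set Atom, IsModelOfKB 𝓡 F M → EntailsQ M Q

/-- `R(F)`: the minimal atom set including `F` and `out(t)` for every trigger `t`
with rule `R` on `F`. -/
def ruleStep (R : Rule) (S : Set Atom) : Set Atom :=
  S ∪ {a | ∃ t : Trigger, t.rule = R ∧ IsHom t.map ↑R.body S ∧ a ∈ t.out}

/-- `𝓡(F) = ⋃_{R ∈ 𝓡} R(F)` (together with `F`). -/
def setStep (𝓡 : RuleSet) (S : Set Atom) : Set Atom := S ∪ ⋃ R ∈ 𝓡, ruleStep R S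

/-- The breadth-first chase `Ch_i(⟨𝓡, F⟩)`. -/
def ch (𝓡 : RuleSet) (F : FactBase) : ℕ → Set Atom
  | 0 => ↑F
  | i + 1 => setStep 𝓡 (ch 𝓡 F i)

/-- The bounded derivation depth property. -/
def BDDP (𝓡 : RuleSet) : Prop :=
  ∀ Q : Finset Atom, ∃ k : ℕ, ∀ F : FactBase, KBEntails 𝓡 F Q ↔ EntailsQ (ch 𝓡 F k) Q

/-! ### Conservative extensions -/

/-- The restriction of an atom set to the atoms over a given set of predicates. -/
def restrictTo (M : Set Atom) (P : Set ℕ) : Set Atom := {a ∈ M | a.pred ∈ P}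

/-- The terms (domain elements) of an atom set. -/
def termsOf (M : Set Atom) : Set Term := {u | ∃ a ∈ M, u ∈ a.args}

/-- `𝓡'` is a conservative extension of `𝓡`. -/
def ConservativeExt (𝓡 𝓡' : RuleSet) : Prop :=
  (↑(RuleSet.predsF 𝓡) : Set ℕ) ⊆ ↑(RuleSet.predsF 𝓡') ∧
  (∀ M : Set Atom, IsModelOfRules 𝓡' M →
    IsModelOfRules 𝓡 (restrictTo M ↑(RuleSet.predsF 𝓡))) ∧
  (∀ M : Set Atom, IsModelOfRules 𝓡 M →
    ∃ M' : Set Atom, M ⊆ M' ∧ IsModelOfRules 𝓡' M' ∧ termsOf M' = termsOf M ∧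
      restrictTo M' ↑(RuleSet.predsF 𝓡) = restrictTo M ↑(RuleSet.predsF 𝓡))

/-- `𝓡'` is a universal-conservative extension of `𝓡`. -/
def UnivConservativeExt (𝓡 𝓡' : RuleSet) : Prop :=
  (↑(RuleSet.predsF 𝓡) : Set ℕ) ⊆ ↑(RuleSet.predsF 𝓡') ∧
  ∀ F : FactBase, (∀ a ∈ F, a.pred ∈ RuleSet.predsF 𝓡) →
    (∀ M : Set Atom, IsUniversalModel 𝓡' F M →
      IsUniversalModel 𝓡 F (restrictTo M ↑(RuleSet.predsF 𝓡))) ∧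
    (∀ M : Set Atom, IsUniversalModel 𝓡 F M →
      ∃ M' : Set Atom, M ⊆ M' ∧ IsUniversalModel 𝓡' F M' ∧ termsOf M' = termsOf M ∧
        restrictTo M' ↑(RuleSet.predsF 𝓡) = restrictTo M ↑(RuleSet.predsF 𝓡))

theorem Atom.mem_vars {a : Atom} {v : ℕ} : v ∈ a.vars ↔ Term.var v ∈ a.args := by
  obtain ⟨p, l⟩ := a
  induction l with
  | nil => simp [Atom.vars]
  | cons u l ih =>
    simp only [Atom.vars, List.foldr_cons, Finset.mem_union, List.mem_cons] at ih ⊢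
    rw [ih]
    cases u <;> simp [Term.vars]

theorem FactBase.mem_vars {F : FactBase} {v : ℕ} :
    v ∈ FactBase.vars F ↔ ∃ a ∈ F, v ∈ a.vars := by
  simp [FactBase.vars, Finset.mem_sup]

theorem FactBase.vars_singleton (a : Atom) : FactBase.vars {a} = a.vars := by
  simp [FactBase.vars]

theorem Atom.subst_eq_iff {a : Atom} {σ τ : Subst} :
    a.subst σ = a.subst τ ↔ ∀ v ∈ a.vars, σ v = τ v := by
  simp only [Atom.subst, Atom.mk.injEq, true_and, List.map_inj_left]
  constructor
  · intro h v hv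
    exact h _ (Atom.mem_vars.1 hv)
  · rintro h (c | v) hu
    · rfl
    · exact h v (Atom.mem_vars.2 hu)

theorem applyTerm_applyTerm (ρ σ : Subst) (u : Term) :
    applyTerm ρ (applyTerm σ u) = applyTerm (fun v => applyTerm ρ (σ v)) u := by
  cases u <;> rfl

theorem Atom.subst_subst (a : Atom) (ρ σ : Subst) :
    (a.subst σ).subst ρ = a.subst fun v => applyTerm ρ (σ v) := by
  simp [Atom.subst, applyTerm_applyTerm]

theorem Atom.subst_injective {ρ : Subst} (hρ : Function.Injective (applyTerm ρ)) :
    Function.Injective (Atom.subst ρ) := by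
  rintro ⟨p, l⟩ ⟨q, m⟩ h
  simp only [Atom.subst, Atom.mk.injEq] at h
  rw [h.1, List.map_injective_iff.2 hρ h.2]

/-! ### The rules of the atomic decompositions -/

/-- The rule `B → ∃z.X_R(x,z)`. -/
def xRule (𝓡 : RuleSet) (R : Rule) : Rule :=
  ⟨R.body, {xAtom 𝓡 R}, R.body_nonempty, Finset.singleton_nonempty _⟩

/-- The rule `X_R(x,z) → P(t)`. -/
def headRule (𝓡 : RuleSet) (R : Rule) (p : Atom) : Rule :=
  ⟨{xAtom 𝓡 R}, {p}, Finset.singleton_nonempty _, Finset.singleton_nonempty _⟩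

/-- The rule `H[x,z] → X_R(x,z)`. -/
def backRule (𝓡 : RuleSet) (R : Rule) : Rule :=
  ⟨R.head, {xAtom 𝓡 R}, R.head_nonempty, Finset.singleton_nonempty _⟩

theorem xRule_mem_oneAd {𝓡 : RuleSet} {R : Rule} (hR : R ∈ 𝓡) : xRule 𝓡 R ∈ oneAd 𝓡 :=
  Finset.mem_biUnion.2 ⟨R, hR, Finset.mem_insert_self _ _⟩

theorem headRule_mem_oneAd {𝓡 : RuleSet} {R : Rule} (hR : R ∈ 𝓡) {p : Atom}
    (hp : p ∈ R.head) : headRule 𝓡 R p ∈ oneAd 𝓡 :=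
  Finset.mem_biUnion.2 ⟨R, hR, Finset.mem_insert_of_mem
    (Finset.mem_image.2 ⟨⟨p, hp⟩, Finset.mem_attach _ _, rfl⟩)⟩

theorem mem_twoAd {𝓡 : RuleSet} {Q : Rule} (h : Q ∈ twoAd 𝓡) :
    ∃ R ∈ 𝓡, Q = xRule 𝓡 R ∨ (∃ p ∈ R.head, Q = headRule 𝓡 R p) ∨ Q = backRule 𝓡 R := by
  rcases Finset.mem_union.1 h with h | h
  · obtain ⟨R, hR, h⟩ := Finset.mem_biUnion.1 h
    rcases Finset.mem_insert.1 h with rfl | h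
    · exact ⟨R, hR, Or.inl rfl⟩
    · obtain ⟨p, -, rfl⟩ := Finset.mem_image.1 h
      exact ⟨R, hR, Or.inr (Or.inl ⟨p.1, p.2, rfl⟩)⟩
  · obtain ⟨R, hR, rfl⟩ := Finset.mem_image.1 h
    exact ⟨R, hR, Or.inr (Or.inr rfl)⟩

theorem xAtom_vars (𝓡 : RuleSet) (R : Rule) : (xAtom 𝓡 R).vars = FactBase.vars R.head := by
  ext v
  rw [Atom.mem_vars]
  simp only [xAtom, List.mem_append, List.mem_map, Finset.mem_sort, Term.var.injEq,
    exists_eq_right, Rule.frontier, Rule.exVars, Finset.mem_inter, Finset.mem_sdiff]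
  tauto

theorem vars_subset_vars_head {R : Rule} {p : Atom} (hp : p ∈ R.head) :
    p.vars ⊆ FactBase.vars R.head := fun _ hv => FactBase.mem_vars.2 ⟨p, hp, hv⟩

theorem xRule_exVars (𝓡 : RuleSet) (R : Rule) : (xRule 𝓡 R).exVars = R.exVars := by
  simp [Rule.exVars, xRule, FactBase.vars_singleton, xAtom_vars]

theorem freshPred_injective (𝓡 : RuleSet) : Function.Injective (freshPred 𝓡) := by
  intro R S h
  exact Encodable.encode_injective (Nat.add_left_cancel h)

/-- The predicate of the atom is none of the fresh predicates `X_R` with `R ∈ 𝓡`. -/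
def NonFresh (𝓡 : RuleSet) (a : Atom) : Prop := ∀ R ∈ 𝓡, a.pred ≠ freshPred 𝓡 R

theorem ne_freshPred_of_mem {𝓡 : RuleSet} {p : ℕ} (h : p ∈ RuleSet.predsF 𝓡) (R : Rule) :
    p ≠ freshPred 𝓡 R := by
  have : p ≤ (RuleSet.predsF 𝓡).sup id := Finset.le_sup (f := id) h
  unfold freshPred
  omega

theorem nonFresh_of_mem {𝓡 : RuleSet} {R : Rule} (hR : R ∈ 𝓡) {a : Atom}
    (ha : a ∈ R.body ∨ a ∈ R.head) (σ : Subst) : NonFresh 𝓡 (a.subst σ) := by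
  intro S _
  refine ne_freshPred_of_mem ?_ S
  refine Finset.mem_sup.2 ⟨R, hR, ?_⟩
  rw [Finset.mem_union, Finset.mem_image, Finset.mem_image]
  exact ha.imp (fun h => ⟨a, h, rfl⟩) (fun h => ⟨a, h, rfl⟩)

theorem xAtom_subst_eq {𝓡 : RuleSet} {R S : Rule} {σ τ : Subst}
    (h : (xAtom 𝓡 R).subst σ = (xAtom 𝓡 S).subst τ) :
    R = S ∧ ∀ v ∈ FactBase.vars R.head, σ v = τ v := by
  have hRS : R = S := freshPred_injective 𝓡 (congrArg Atom.pred h)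
  subst hRS
  rw [Atom.subst_eq_iff, xAtom_vars] at h
  exact ⟨rfl, h⟩

theorem xAtom_not_nonFresh {𝓡 : RuleSet} {R : Rule} (hR : R ∈ 𝓡) (σ : Subst) :
    ¬ NonFresh 𝓡 ((xAtom 𝓡 R).subst σ) := fun h => h R hR rfl

theorem exists_rule_notMem (𝓡 : RuleSet) : ∃ R : Rule, R ∉ 𝓡 := by
  let a : Atom := ⟨(RuleSet.predsF 𝓡).sup id + 1, []⟩
  refine ⟨⟨{a}, {a}, Finset.singleton_nonempty _, Finset.singleton_nonempty _⟩, fun h => ?_⟩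
  have ha : a.pred ∈ RuleSet.predsF 𝓡 := Finset.mem_sup.2 ⟨_, h, by simp⟩
  have : a.pred ≤ (RuleSet.predsF 𝓡).sup id := Finset.le_sup (f := id) ha
  exact absurd this (Nat.not_succ_le_self _)

/-! ### Triggers and applicability -/

/-- The images of the body variables under the substitution of a trigger. -/
def Trigger.bodyVals (t : Trigger) : List Term :=
  ((FactBase.vars t.rule.body).sort (· ≤ ·)).map t.map

theorem Trigger.bodyVals_eq_iff {t t' : Trigger} (h : t.rule.body = t'.rule.body) :
    t.bodyVals = t'.bodyVals ↔ ∀ v ∈ FactBase.vars t.rule.body, t.map v = t'.map v := by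
  simp [Trigger.bodyVals, ← h, List.map_inj_left]

theorem mem_out {t : Trigger} {a : Atom} :
    a ∈ t.out ↔ ∃ p ∈ t.rule.head, p.subst t.ext = a := by
  simp [Trigger.out]

theorem Trigger.ext_of_not_exVars {t : Trigger} {v : ℕ} (h : v ∉ t.rule.exVars) :
    t.ext v = t.map v := if_neg h

theorem Trigger.out_congr {t t' : Trigger} (h : t.rule = t'.rule)
    (hext : ∀ v ∈ FactBase.vars t.rule.head, t.ext v = t'.ext v) : t.out = t'.out := by
  unfold Trigger.out
  rw [← h]
  refine Finset.image_congr fun a ha => ?_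
  exact Atom.subst_eq_iff.2 fun v hv => hext v (vars_subset_vars_head ha hv)

theorem Trigger.out_eq_of_bodyVals {t t' : Trigger} (h : t.rule = t'.rule)
    (hb : t.bodyVals = t'.bodyVals) : t.out = t'.out := by
  refine Trigger.out_congr h fun v hv => ?_
  by_cases hz : v ∈ t.rule.exVars
  · have : t.freshVar v = t'.freshVar v := by
      change Nat.pair (Encodable.encode (t.rule, t.bodyVals)) v =
        Nat.pair (Encodable.encode (t'.rule, t'.bodyVals)) v
      rw [h, hb]
    rw [Trigger.ext, Trigger.ext, if_pos hz, if_pos (h ▸ hz), this]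
  · rw [Trigger.ext_of_not_exVars hz, Trigger.ext_of_not_exVars (h ▸ hz)]
    refine (Trigger.bodyVals_eq_iff (congrArg Rule.body h)).1 hb v ?_
    by_contra hv'
    exact hz (Finset.mem_sdiff.2 ⟨hv, hv'⟩)

/-- The variables whose images identify a trigger in the given chase variant. -/
def Variant.keyVars : Variant → Rule → Finset ℕ
  | .O, Q => FactBase.vars Q.body
  | _, Q => Q.frontier

theorem frontier_subset_keyVars (X : Variant) (R : Rule) : R.frontier ⊆ X.keyVars R := by
  cases X
  · exact Finset.inter_subset_left
  all_goals exact subset_rfl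

theorem keyVars_subset_body (X : Variant) (R : Rule) :
    X.keyVars R ⊆ FactBase.vars R.body := by
  cases X
  · exact subset_rfl
  all_goals exact Finset.inter_subset_left

theorem keyVars_xRule (X : Variant) (𝓡 : RuleSet) (R : Rule) :
    X.keyVars (xRule 𝓡 R) = X.keyVars R := by
  cases X <;> simp [Variant.keyVars, Rule.frontier, xRule, FactBase.vars_singleton, xAtom_vars]

/-- Two triggers of the same rule that the given chase variant does not distinguish. -/
def SameKey (X : Variant) (t' t : Trigger) : Prop :=
  t'.rule = t.rule ∧ ∀ v ∈ X.keyVars t.rule, t'.map v = t.map v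

theorem SameKey.refl (X : Variant) (t : Trigger) : SameKey X t t := ⟨rfl, fun _ _ => rfl⟩

theorem SameKey.symm {X : Variant} {t t' : Trigger} (h : SameKey X t' t) : SameKey X t t' :=
  ⟨h.1.symm, fun v hv => (h.2 v (h.1 ▸ hv)).symm⟩

theorem SameKey.trans {X : Variant} {t t' t'' : Trigger} (h : SameKey X t'' t')
    (h' : SameKey X t' t) : SameKey X t'' t :=
  ⟨h.1.trans h'.1, fun v hv => (h.2 v (h'.1 ▸ hv)).trans (h'.2 v hv)⟩

theorem not_applicable_iff {X : Variant} (hX : X = Variant.O ∨ X = Variant.SO)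
    {t : Trigger} {F : FactBase} :
    ¬ Applicable X t F ↔ ∃ t', SameKey X t' t ∧ t'.out ⊆ F := by
  rcases hX with rfl | rfl
  · simp only [Applicable, not_not]
    constructor
    · exact fun h => ⟨t, SameKey.refl _ _, h⟩
    · rintro ⟨t', ht, h⟩
      rwa [← Trigger.out_eq_of_bodyVals ht.1
        ((Trigger.bodyVals_eq_iff (congrArg Rule.body ht.1)).2 (ht.1 ▸ ht.2))]
  · simp only [Applicable, SameKey, Variant.keyVars]
    push Not
    exact ⟨fun ⟨t', h1, h2, h3⟩ => ⟨t', ⟨h1, h2⟩, h3⟩, fun ⟨t', ⟨h1, h2⟩, h3⟩ => ⟨t', h1, h2, h3⟩⟩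

theorem out_not_subset_of_applicable {X : Variant} (hX : X = Variant.O ∨ X = Variant.SO)
    {t : Trigger} {F : FactBase} (h : Applicable X t F) : ¬ t.out ⊆ F := fun h' =>
  (not_applicable_iff hX).2 ⟨t, SameKey.refl _ _, h'⟩ h

/-- A chain of factbases whose changes are all applications of applicable triggers, that
never becomes stationary and that eventually satisfies every trigger, refutes `CTall`. -/
theorem not_ctall_of_chain {X : Variant} (hX : X = Variant.O ∨ X = Variant.SO) {𝓡 : RuleSet}
    (A : ℕ → FactBase) (s : ℕ → Trigger)
    (hstep : ∀ i, A (i + 1) = A i ∨ (A (i + 1) = A i ∪ (s i).out ∧ (s i).rule ∈ 𝓡 ∧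
      (s i).IsOn (A i) ∧ Applicable X (s i) (A i)))
    (hinf : ∀ i, ∃ j, i ≤ j ∧ A (j + 1) ≠ A j)
    (hfair : ∀ i t, t.rule ∈ 𝓡 → t.IsOn (A i) → ∃ j, ¬ Applicable X t (A j)) :
    ¬ CTall X 𝓡 := by
  intro hct
  set p : ℕ → Prop := fun i => A (i + 1) ≠ A i with hp
  have hpinf : (Set.ofPred p).Infinite := by
    refine Set.infinite_of_forall_exists_gt fun i => ?_
    obtain ⟨j, hj, h⟩ := hinf (i + 1)
    exact ⟨j, h, hj⟩
  have hmono : Monotone A := by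
    refine monotone_nat_of_le_succ fun i => ?_
    rcases hstep i with h | h
    · exact h.ge
    · rw [h.1]; exact Finset.subset_union_left
  have hconst : ∀ a b, a ≤ b → (∀ i, a ≤ i → i < b → ¬ p i) → A b = A a := by
    intro a b hab
    induction b, hab using Nat.le_induction with
    | base => intro _; rfl
    | succ b hab ih =>
      intro h
      rw [← ih fun i h1 h2 => h i h1 (by omega)]
      exact not_not.1 (h b hab (Nat.lt_succ_self b))
  have hnth : ∀ k, p (Nat.nth p k) := fun k => Nat.nth_mem_of_infinite hpinf k
  have hs : ∀ k, _ := fun k => (hstep (Nat.nth p k)).resolve_left (hnth k)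
  let D : Derivation 𝓡 (A 0) :=
    { len := ⊤
      fb := fun k => A (Nat.nth p k)
      tr := fun k => s (Nat.nth p k)
      fb_zero := hconst _ _ (Nat.zero_le _) fun i _ hi hpi => by
        have := Nat.nth_count hpi
        have h0 := (Nat.nth_strictMono hpinf).monotone (Nat.zero_le (Nat.count p i))
        omega
      rule_mem := fun k _ => (hs k).2.1
      trig_on := fun k _ => (hs k).2.2.1
      trig_new := fun k _ => out_not_subset_of_applicable hX (hs k).2.2.2
      fb_succ := fun k _ => by
        rw [← (hs k).1]
        refine hconst _ _ (Nat.nth_strictMono hpinf (Nat.lt_succ_self k)) fun i h1 h2 hpi => ?_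
        have := Nat.le_nth_of_lt_nth_succ h2 hpi
        omega
      fb_stall := fun k hk => absurd (ENat.natCast_lt_top k) hk }
  refine hct (A 0) D (fun k _ => (hs k).2.2.2) (fun k _ t ht hon _ => ?_) rfl
  obtain ⟨j, hj⟩ := hfair _ t ht hon
  refine ⟨max j (k + 1), by omega, le_top, ?_⟩
  rw [not_applicable_iff hX] at hj ⊢
  obtain ⟨t', h1, h2⟩ := hj
  refine ⟨t', h1, h2.trans (hmono ?_)⟩
  exact (le_max_left j (k + 1)).trans ((Nat.nth_strictMono hpinf).le_apply)

/-! ### Renaming the fresh variables -/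

/-- The index of the fresh variable for the existential variable `z` of a trigger of the
rule `R` with the given images of the body variables. -/
def freshCode (R : Rule) (l : List Term) (z : ℕ) : ℕ := Nat.pair (Encodable.encode (R, l)) z

theorem freshVar_eq (t : Trigger) (z : ℕ) :
    t.freshVar z = freshCode t.rule t.bodyVals z := rfl

theorem freshCode_inj {R S : Rule} {l m : List Term} {y z : ℕ}
    (h : freshCode R l y = freshCode S m z) : R = S ∧ l = m ∧ y = z := by
  obtain ⟨h1, h2⟩ := Nat.pair_eq_pair.1 h
  have h3 := Encodable.encode_injective h1
  exact ⟨congrArg Prod.fst h3, congrArg Prod.snd h3, h2⟩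

theorem lt_freshCode {R : Rule} {l : List Term} {w : ℕ} (h : Term.var w ∈ l) (z : ℕ) :
    w < freshCode R l z := by
  have h1 : w < Encodable.encode l := by
    induction l with
    | nil => simp at h
    | cons u l ih =>
      rw [Encodable.encode_list_cons]
      rcases List.mem_cons.1 h with rfl | h
      · have : Encodable.encode (Term.var w) = 2 * w + 1 := rfl
        have := Nat.left_le_pair (Encodable.encode (Term.var w)) (Encodable.encode l)
        omega
      · have := Nat.right_le_pair (Encodable.encode u) (Encodable.encode l)
        have := ih h
        omega
  have h2 : Encodable.encode (R, l) = Nat.pair (Encodable.encode R) (Encodable.encode l) := rfl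
  have h3 := Nat.right_le_pair (Encodable.encode R) (Encodable.encode l)
  have h4 := Nat.left_le_pair (Encodable.encode (R, l)) z
  unfold freshCode
  omega

/-- Recursively replace the fresh variables of the selected triggers of the rules
`B → ∃z.X_R(x,z)` by those of the corresponding triggers of `R`; all other variables become
fresh variables of the rule `J`. -/
def rename (𝓡 : RuleSet) (pres : Rule → List Term → Prop) (J : Rule) (v : ℕ) : ℕ :=
  if h : ∃ q : Rule × List Term × ℕ, pres q.1 q.2.1 ∧ v = freshCode (xRule 𝓡 q.1) q.2.1 q.2.2 then
    freshCode h.choose.1 (h.choose.2.1.map fun u => match u with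
      | .const c => .const c
      | .var w => if _ : w < v then .var (rename 𝓡 pres J w) else .var w) h.choose.2.2
  else freshCode J [.var v] 0
termination_by v

/-- The substitution induced by `rename`. -/
def renSubst (𝓡 : RuleSet) (pres : Rule → List Term → Prop) (J : Rule) : Subst :=
  fun v => .var (rename 𝓡 pres J v)

theorem xRule_injective (𝓡 : RuleSet) : Function.Injective (xRule 𝓡) := by
  intro R S h
  have : xAtom 𝓡 R = xAtom 𝓡 S := Finset.singleton_injective (congrArg Rule.head h)
  exact freshPred_injective 𝓡 (congrArg Atom.pred this)

theorem rename_freshCode (𝓡 : RuleSet) {pres : Rule → List Term → Prop} (J : Rule) {R : Rule}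
    {l : List Term} (h : pres R l) (z : ℕ) :
    rename 𝓡 pres J (freshCode (xRule 𝓡 R) l z) =
      freshCode R (l.map (applyTerm (renSubst 𝓡 pres J))) z := by
  have hex : ∃ q : Rule × List Term × ℕ, pres q.1 q.2.1 ∧
      freshCode (xRule 𝓡 R) l z = freshCode (xRule 𝓡 q.1) q.2.1 q.2.2 := ⟨(R, l, z), h, rfl⟩
  obtain ⟨h1, h2, h3⟩ := freshCode_inj hex.choose_spec.2
  have h1 := xRule_injective 𝓡 h1
  rw [rename, dif_pos hex, ← h1, ← h2, ← h3]
  congr 1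
  refine List.map_congr_left fun u hu => ?_
  cases u with
  | const c => rfl
  | var w => simp [lt_freshCode hu, applyTerm, renSubst]

theorem rename_cases (𝓡 : RuleSet) (pres : Rule → List Term → Prop) (J : Rule) (v : ℕ) :
    (∃ R l z, pres R l ∧ v = freshCode (xRule 𝓡 R) l z ∧
      rename 𝓡 pres J v = freshCode R (l.map (applyTerm (renSubst 𝓡 pres J))) z) ∨
    rename 𝓡 pres J v = freshCode J [.var v] 0 := by
  by_cases h : ∃ q : Rule × List Term × ℕ,
      pres q.1 q.2.1 ∧ v = freshCode (xRule 𝓡 q.1) q.2.1 q.2.2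
  · obtain ⟨⟨R, l, z⟩, hp, rfl⟩ := h
    exact Or.inl ⟨R, l, z, hp, rfl, rename_freshCode 𝓡 J hp z⟩
  · right
    rw [rename, dif_neg h]

theorem rename_injective {𝓡 : RuleSet} {pres : Rule → List Term → Prop} {J : Rule}
    (hpres : ∀ R l, pres R l → R ≠ J) : Function.Injective (rename 𝓡 pres J) := by
  intro v
  induction v using Nat.strong_induction_on with
  | _ v ih =>
    intro w hvw
    rcases rename_cases 𝓡 pres J v with ⟨R, l, z, hp, hv, hr⟩ | hr <;>
    rcases rename_cases 𝓡 pres J w with ⟨S, m, y, hp', hw, hr'⟩ | hr' <;>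
    rw [hr, hr'] at hvw <;> obtain ⟨h1, h2, h3⟩ := freshCode_inj hvw
    · subst h1 h3
      suffices l = m by rw [hv, hw, this]
      have key : ∀ u ∈ l, ∀ u', applyTerm (renSubst 𝓡 pres J) u =
          applyTerm (renSubst 𝓡 pres J) u' → u = u' := by
        rintro (c | a) hu (d | b) h
        · simpa [applyTerm] using h
        · simp [applyTerm, renSubst] at h
        · simp [applyTerm, renSubst] at h
        · rw [ih a (hv ▸ lt_freshCode hu z) (by simpa [applyTerm, renSubst] using h)]
      clear hv hw hr hr' hvw hp hp' ih
      induction l generalizing m with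
      | nil => simpa using h2.symm
      | cons u l ihl =>
        cases m with
        | nil => simp at h2
        | cons u' m =>
          rw [List.map_cons, List.map_cons, List.cons.injEq] at h2
          rw [key u (by simp) u' h2.1, ihl m h2.2 fun x hx => key x (by simp [hx])]
    · exact absurd h1 (hpres R l hp)
    · exact absurd h1.symm (hpres S m hp')
    · simpa using h2

theorem applyTerm_renSubst_injective {𝓡 : RuleSet} {pres : Rule → List Term → Prop} {J : Rule}
    (hpres : ∀ R l, pres R l → R ≠ J) :
    Function.Injective (applyTerm (renSubst 𝓡 pres J)) := by
  rintro (c | a) (d | b) h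
  · simpa [applyTerm] using h
  · simp [applyTerm, renSubst] at h
  · simp [applyTerm, renSubst] at h
  · exact congrArg Term.var (rename_injective hpres (by simpa [applyTerm, renSubst] using h))

/-- The trigger of `R` obtained by composing the substitution of a trigger with `ρ`. -/
def Trigger.transfer (t : Trigger) (R : Rule) (ρ : Subst) : Trigger :=
  ⟨R, fun v => applyTerm ρ (t.map v)⟩

theorem transfer_bodyVals {𝓡 : RuleSet} {R : Rule} {t : Trigger} (ht : t.rule = xRule 𝓡 R)
    (ρ : Subst) : (t.transfer R ρ).bodyVals = t.bodyVals.map (applyTerm ρ) := by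
  simp [Trigger.bodyVals, Trigger.transfer, ht, xRule, Function.comp_def]

theorem transfer_ext {𝓡 : RuleSet} {pres : Rule → List Term → Prop} {J R : Rule} {t : Trigger}
    (ht : t.rule = xRule 𝓡 R) (hp : pres R t.bodyVals) (v : ℕ) :
    (t.transfer R (renSubst 𝓡 pres J)).ext v = applyTerm (renSubst 𝓡 pres J) (t.ext v) := by
  by_cases hz : v ∈ R.exVars
  · rw [Trigger.ext, Trigger.ext, if_pos (show v ∈ (t.transfer R _).rule.exVars from hz),
      if_pos (by rwa [ht, xRule_exVars]), freshVar_eq, freshVar_eq, transfer_bodyVals ht, ht]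
    exact congrArg Term.var (rename_freshCode 𝓡 J hp v).symm
  · rw [Trigger.ext_of_not_exVars (show v ∉ (t.transfer R _).rule.exVars from hz),
      Trigger.ext_of_not_exVars (by rwa [ht, xRule_exVars])]
    rfl

theorem mem_transfer_out {𝓡 : RuleSet} {pres : Rule → List Term → Prop} {J R : Rule}
    {t : Trigger} (ht : t.rule = xRule 𝓡 R) (hp : pres R t.bodyVals) {b : Atom} :
    b ∈ (t.transfer R (renSubst 𝓡 pres J)).out ↔
      ∃ p ∈ R.head, (p.subst t.ext).subst (renSubst 𝓡 pres J) = b := by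
  rw [mem_out]
  simp only [Atom.subst_subst, ← transfer_ext ht hp]
  rfl

theorem out_of_singleton_head {t : Trigger} {a : Atom} (h : t.rule.head = {a}) :
    t.out = {a.subst t.ext} := by
  simp [Trigger.out, h]

theorem subst_ext_of_vars_subset {t : Trigger} {a : Atom}
    (h : a.vars ⊆ FactBase.vars t.rule.body) : a.subst t.ext = a.subst t.map :=
  Atom.subst_eq_iff.2 fun _ hv => Trigger.ext_of_not_exVars fun hz =>
    (Finset.mem_sdiff.1 hz).2 (h hv)

/-! ### Finiteness -/

theorem finite_head_instances (𝓡 : RuleSet) (F : FactBase) :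
    {b | ∃ R ∈ 𝓡, ∃ p ∈ R.head, ∃ σ : Subst,
      (xAtom 𝓡 R).subst σ ∈ F ∧ b = p.subst σ}.Finite := by
  have h : (⋃ R ∈ 𝓡, ⋃ p ∈ R.head, ⋃ a ∈ F,
      {b | ∃ σ : Subst, p ∈ R.head ∧ (xAtom 𝓡 R).subst σ = a ∧ b = p.subst σ}).Finite := by
    refine Set.Finite.biUnion 𝓡.finite_toSet fun R _ => Set.Finite.biUnion R.head.finite_toSet
      fun p _ => Set.Finite.biUnion F.finite_toSet fun a _ => Set.Subsingleton.finite ?_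
    rintro b ⟨σ, hp, h1, rfl⟩ c ⟨τ, -, h2, rfl⟩
    exact Atom.subst_eq_iff.2 fun v hv =>
      (xAtom_subst_eq (h1.trans h2.symm)).2 v (vars_subset_vars_head hp hv)
  refine h.subset ?_
  rintro b ⟨R, hR, p, hp, σ, ha, rfl⟩
  simp only [Set.mem_iUnion]
  exact ⟨R, hR, p, hp, _, ha, σ, hp, rfl, rfl⟩

theorem finite_xAtom_instances (𝓡 : RuleSet) (C : FactBase) {ρ : Subst}
    (hρ : Function.Injective (applyTerm ρ)) :
    {a | ∃ R ∈ 𝓡, ∃ σ : Subst, a = (xAtom 𝓡 R).subst σ ∧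
      ∀ p ∈ R.head, (p.subst σ).subst ρ ∈ C}.Finite := by
  have h : (⋃ R ∈ 𝓡, {a | ∃ σ : Subst, a = (xAtom 𝓡 R).subst σ ∧
      ∀ p ∈ R.head, (p.subst σ).subst ρ ∈ C}).Finite := by
    refine Set.Finite.biUnion 𝓡.finite_toSet fun R _ => ?_
    let g : (R.head → C) → Atom := fun f =>
      if hf : ∃ σ : Subst, ∀ p : R.head, (f p : Atom) = (p.1.subst σ).subst ρ then
        (xAtom 𝓡 R).subst hf.choose else xAtom 𝓡 R
    refine (Set.finite_range g).subset ?_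
    rintro a ⟨σ, rfl, hσ⟩
    refine ⟨fun p => ⟨(p.1.subst σ).subst ρ, hσ p.1 p.2⟩, ?_⟩
    have hf : ∃ τ : Subst, ∀ p : R.head,
        (p.1.subst σ).subst ρ = (p.1.subst τ).subst ρ := ⟨σ, fun _ => rfl⟩
    refine (dif_pos hf).trans ?_
    rw [Atom.subst_eq_iff, xAtom_vars]
    intro v hv
    obtain ⟨p, hp, hv⟩ := FactBase.mem_vars.1 hv
    exact (Atom.subst_eq_iff.1 (Atom.subst_injective hρ (hf.choose_spec ⟨p, hp⟩)) v hv).symm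
  refine h.subset ?_
  rintro a ⟨R, hR, ha⟩
  simp only [Set.mem_iUnion]
  exact ⟨R, hR, ha⟩

theorem exists_uniform_index {α : Type*} (s : Finset α) {P : α → ℕ → Prop}
    (hP : ∀ a i j, i ≤ j → P a i → P a j) (h : ∀ a ∈ s, ∃ i, P a i) : ∃ i, ∀ a ∈ s, P a i := by
  choose! f hf using h
  exact ⟨s.sup f, fun a ha => hP a _ _ (Finset.le_sup ha) (hf a ha)⟩

/-- Choose a representative of every class of triggers with the same key, preferring the
given triggers, and otherwise those with a given property. -/
theorem exists_representatives (X : Variant) (tr : ℕ → Trigger) {good : Trigger → Prop}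
    (hinj : ∀ i j, SameKey X (tr i) (tr j) → tr i = tr j) (hgood : ∀ i, good (tr i)) :
    ∃ rep : Trigger → Trigger, (∀ t t', SameKey X t' t → rep t' = rep t) ∧
      (∀ t, SameKey X (rep t) t) ∧ (∀ i, rep (tr i) = tr i) ∧
      ∀ t t', SameKey X t' t → good t' → good (rep t) := by
  let S : Setoid Trigger := ⟨SameKey X, SameKey.refl X, SameKey.symm, SameKey.trans⟩
  have hex : ∀ q : Quotient S, ∃ r : Trigger, Quotient.mk S r = q ∧
      (∀ i, Quotient.mk S (tr i) = q → r = tr i) ∧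
      ((∃ t', Quotient.mk S t' = q ∧ good t') → good r) := by
    intro q
    by_cases h1 : ∃ i, Quotient.mk S (tr i) = q
    · obtain ⟨i, hi⟩ := h1
      exact ⟨tr i, hi, fun j hj => hinj i j (Quotient.exact (hi.trans hj.symm)),
        fun _ => hgood i⟩
    · by_cases h2 : ∃ t', Quotient.mk S t' = q ∧ good t'
      · obtain ⟨t', ht, hg⟩ := h2
        exact ⟨t', ht, fun i hi => absurd ⟨i, hi⟩ h1, fun _ => hg⟩
      · exact ⟨q.out, q.out_eq, fun i hi => absurd ⟨i, hi⟩ h1, fun h => absurd h h2⟩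
  choose f hf1 hf2 hf3 using hex
  refine ⟨fun t => f (Quotient.mk S t), fun t t' h => ?_, fun t => ?_, fun i => ?_,
    fun t t' h hg => ?_⟩
  · exact congrArg f (Quotient.sound h)
  · exact Quotient.exact (hf1 (Quotient.mk S t))
  · exact hf2 _ i rfl
  · exact hf3 _ ⟨t', Quotient.sound h, hg⟩

/-! ### Preservation of termination -/

theorem ctall_of_oneAd_subset_of_subset_twoAd {X : Variant}
    (hX : X = Variant.O ∨ X = Variant.SO) {𝓡 𝓢 : RuleSet} (h : CTall X 𝓡)
    (h1 : oneAd 𝓡 ⊆ 𝓢) (h2 : 𝓢 ⊆ twoAd 𝓡) : CTall X 𝓢 := by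
  intro F D hDX hDF hlen
  have hlt : ∀ i : ℕ, (i : ℕ∞) < D.len := fun i => hlen ▸ ENat.natCast_lt_top i
  have hmono : Monotone D.fb := monotone_nat_of_le_succ fun i => by
    rw [D.fb_succ i (hlt i)]; exact Finset.subset_union_left
  have hout : ∀ i, (D.tr i).out ⊆ D.fb (i + 1) := fun i => by
    rw [D.fb_succ i (hlt i)]; exact Finset.subset_union_right
  have hevt : ∀ i t, t.rule ∈ 𝓢 → t.IsOn (D.fb i) →
      ∃ j t', SameKey X t' t ∧ t'.out ⊆ D.fb j := by
    intro i t ht hon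
    by_cases ha : Applicable X t (D.fb i)
    · obtain ⟨j, -, -, hj⟩ := hDF i (hlt i).le t ht hon ha
      exact ⟨j, (not_applicable_iff hX).1 hj⟩
    · exact ⟨i, (not_applicable_iff hX).1 ha⟩
  have hhead : ∀ R ∈ 𝓡, ∀ p ∈ R.head, ∀ (σ : Subst) (i : ℕ),
      (xAtom 𝓡 R).subst σ ∈ D.fb i → ∃ j, p.subst σ ∈ D.fb j := by
    intro R hR p hp σ i hi
    obtain ⟨j, t', hk, ho⟩ := hevt i ⟨headRule 𝓡 R p, σ⟩ (h1 (headRule_mem_oneAd hR hp)) (by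
      intro a ha
      obtain rfl := Finset.mem_singleton.1 (Finset.mem_coe.1 ha)
      exact hi)
    have hsub : p.vars ⊆ FactBase.vars (headRule 𝓡 R p).body := by
      rw [headRule, FactBase.vars_singleton, xAtom_vars]
      exact vars_subset_vars_head hp
    refine ⟨j, ho ?_⟩
    rw [out_of_singleton_head (a := p) (by rw [hk.1]; rfl), Finset.mem_singleton,
      subst_ext_of_vars_subset (by rw [hk.1]; exact hsub)]
    refine Atom.subst_eq_iff.2 fun v hv => (hk.2 v (frontier_subset_keyVars _ _
      (Finset.mem_inter.2 ⟨hsub hv, ?_⟩))).symm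
    exact vars_subset_vars_head (R := headRule 𝓡 R p) (Finset.mem_singleton_self p) hv
  have hne : ∀ i j, i < j → ¬ SameKey X (D.tr i) (D.tr j) := fun i j hij hk =>
    (not_applicable_iff hX).2 ⟨_, hk, (hout i).trans (hmono hij)⟩ (hDX j (hlt j))
  obtain ⟨rep, hrep, hrepk, hreptr, hrepg⟩ := exists_representatives X D.tr
    (good := fun t => ∃ j, t.out ⊆ D.fb j)
    (fun i j hk => by
      rcases lt_trichotomy i j with hij | rfl | hij
      · exact absurd hk (hne i j hij)
      · rfl
      · exact absurd hk.symm (hne j i hij))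
    (fun i => ⟨i + 1, hout i⟩)
  obtain ⟨J, hJ⟩ := exists_rule_notMem 𝓡
  let pres : Rule → List Term → Prop := fun R l =>
    R ∈ 𝓡 ∧ ∃ t : Trigger, t.rule = xRule 𝓡 R ∧ (rep t).bodyVals = l
  have hpresJ : ∀ R l, pres R l → R ≠ J := by
    rintro R l ⟨hR, -⟩ rfl
    exact hJ hR
  have hprestr : ∀ i, ∀ R ∈ 𝓡, (D.tr i).rule = xRule 𝓡 R → pres R (D.tr i).bodyVals :=
    fun i R hR hi => ⟨hR, D.tr i, hi, by rw [hreptr]⟩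
  obtain ⟨ρ, hρdef⟩ : ∃ ρ, ρ = renSubst 𝓡 pres J := ⟨_, rfl⟩
  have hρ : Function.Injective (applyTerm ρ) := hρdef ▸ applyTerm_renSubst_injective hpresJ
  have hρA := Atom.subst_injective hρ
  have hFfin := finite_head_instances 𝓡 F
  have hchoice : ∀ i, ∃ (O : FactBase) (s : Trigger),
      (∀ R ∈ 𝓡, (D.tr i).rule = xRule 𝓡 R → s = (D.tr i).transfer R ρ ∧ O = s.out) ∧
      ((∀ R ∈ 𝓡, (D.tr i).rule ≠ xRule 𝓡 R) → O = ∅) := by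
    intro i
    by_cases hi : ∃ R ∈ 𝓡, (D.tr i).rule = xRule 𝓡 R
    · obtain ⟨R, hR, hi⟩ := hi
      refine ⟨((D.tr i).transfer R ρ).out, (D.tr i).transfer R ρ, fun S _ hS => ?_,
        fun hn => absurd hi (hn R hR)⟩
      rw [xRule_injective 𝓡 (hi.symm.trans hS)]
      exact ⟨rfl, rfl⟩
    · exact ⟨∅, D.tr i, fun R hR hRi => absurd ⟨R, hR, hRi⟩ hi, fun _ => rfl⟩
  choose O s hOs hO using hchoice
  let A : ℕ → FactBase := fun i =>
    Nat.rec ((F ∪ hFfin.toFinset).image (Atom.subst ρ)) (fun i B => B ∪ O i) i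
  have hA0 : A 0 = (F ∪ hFfin.toFinset).image (Atom.subst ρ) := rfl
  have hAs : ∀ i, A (i + 1) = A i ∪ O i := fun _ => rfl
  clear_value A
  have hOmem : ∀ i, ∀ R ∈ 𝓡, (D.tr i).rule = xRule 𝓡 R → ∀ b, b ∈ O i ↔
      ∃ p ∈ R.head, (p.subst (D.tr i).ext).subst ρ = b := by
    intro i R hR hi b
    rw [(hOs i R hR hi).2, (hOs i R hR hi).1, hρdef, mem_transfer_out hi (hprestr i R hR hi)]
  have hAmono : Monotone A := monotone_nat_of_le_succ fun i => by
    rw [hAs]; exact Finset.subset_union_left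
  have hinv : ∀ i, ∀ a ∈ D.fb i, (NonFresh 𝓡 a → a.subst ρ ∈ A i) ∧
      (∀ R ∈ 𝓡, ∀ σ : Subst, a = (xAtom 𝓡 R).subst σ →
        ∀ p ∈ R.head, (p.subst σ).subst ρ ∈ A i) ∧
      (a ∈ F ∨ NonFresh 𝓡 a ∨ ∃ R ∈ 𝓡, ∃ σ : Subst, a = (xAtom 𝓡 R).subst σ) := by
    intro i
    induction i with
    | zero =>
      intro a ha
      rw [D.fb_zero] at ha
      refine ⟨fun _ => ?_, ?_, Or.inl ha⟩
      · rw [hA0]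
        exact Finset.mem_image_of_mem _ (Finset.mem_union_left _ ha)
      · rintro R hR σ rfl p hp
        rw [hA0]
        refine Finset.mem_image_of_mem _ (Finset.mem_union_right _ ?_)
        exact hFfin.mem_toFinset.2 ⟨R, hR, p, hp, σ, ha, rfl⟩
    | succ i ih =>
      intro a ha
      have hsub : A i ⊆ A (i + 1) := hAmono (Nat.le_succ i)
      rw [D.fb_succ i (hlt i)] at ha
      rcases Finset.mem_union.1 ha with ha | ha
      · obtain ⟨i1, i2, i3⟩ := ih a ha
        exact ⟨fun hn => hsub (i1 hn), fun R hR σ e p hp => hsub (i2 R hR σ e p hp), i3⟩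
      have hon := D.trig_on i (hlt i)
      obtain ⟨R, hR, hrule | ⟨p, hp, hrule⟩ | hrule⟩ := mem_twoAd (h2 (D.rule_mem i (hlt i)))
      · rw [out_of_singleton_head (a := xAtom 𝓡 R) (by rw [hrule]; rfl),
          Finset.mem_singleton] at ha
        subst ha
        refine ⟨fun hn => absurd hn (xAtom_not_nonFresh hR _), ?_, Or.inr (Or.inr ⟨R, hR, _, rfl⟩)⟩
        intro S hS σ e p hp
        obtain ⟨rfl, hv⟩ := xAtom_subst_eq e
        rw [← Atom.subst_eq_iff.2 fun v hvp => hv v (vars_subset_vars_head hp hvp), hAs]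
        exact Finset.mem_union_right _ ((hOmem i R hR hrule _).2 ⟨p, hp, rfl⟩)
      · rw [out_of_singleton_head (a := p) (by rw [hrule]; rfl), Finset.mem_singleton,
          subst_ext_of_vars_subset (by
            rw [hrule, headRule, FactBase.vars_singleton, xAtom_vars]
            exact vars_subset_vars_head hp)] at ha
        subst ha
        have hnf := nonFresh_of_mem hR (Or.inr hp) (D.tr i).map
        refine ⟨fun _ => hsub ?_, ?_, Or.inr (Or.inl hnf)⟩
        · refine (ih ((xAtom 𝓡 R).subst (D.tr i).map) (hon _ ?_)).2.1 R hR _ rfl p hp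
          rw [hrule]
          exact Finset.mem_coe.2 (Finset.mem_singleton_self _)
        · intro S hS σ e
          rw [e] at hnf
          exact absurd hnf (xAtom_not_nonFresh hS σ)
      · rw [out_of_singleton_head (a := xAtom 𝓡 R) (by rw [hrule]; rfl), Finset.mem_singleton,
          subst_ext_of_vars_subset (by rw [hrule, xAtom_vars]; exact subset_rfl)] at ha
        subst ha
        refine ⟨fun hn => absurd hn (xAtom_not_nonFresh hR _), ?_, Or.inr (Or.inr ⟨R, hR, _, rfl⟩)⟩
        intro S hS σ e p hp
        obtain ⟨rfl, hv⟩ := xAtom_subst_eq e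
        rw [← Atom.subst_eq_iff.2 fun v hvp => hv v (vars_subset_vars_head hp hvp)]
        refine hsub ((ih _ (hon p ?_)).1 (nonFresh_of_mem hR (Or.inr hp) _))
        rw [hrule]
        exact Finset.mem_coe.2 hp
  have hAS : ∀ i, ∀ b ∈ A i, ∃ j, ∃ a ∈ D.fb j, a.subst ρ = b := by
    intro i
    induction i with
    | zero =>
      intro b hb
      rw [hA0] at hb
      obtain ⟨a, ha, rfl⟩ := Finset.mem_image.1 hb
      rcases Finset.mem_union.1 ha with ha | ha
      · exact ⟨0, a, by rwa [D.fb_zero], rfl⟩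
      · obtain ⟨R, hR, p, hp, σ, hx, rfl⟩ := hFfin.mem_toFinset.1 ha
        obtain ⟨j, hj⟩ := hhead R hR p hp σ 0 (by rwa [D.fb_zero])
        exact ⟨j, _, hj, rfl⟩
    | succ i ih =>
      intro b hb
      rw [hAs] at hb
      rcases Finset.mem_union.1 hb with hb | hb
      · exact ih b hb
      by_cases hi : ∃ R ∈ 𝓡, (D.tr i).rule = xRule 𝓡 R
      · obtain ⟨R, hR, hi⟩ := hi
        obtain ⟨p, hp, rfl⟩ := (hOmem i R hR hi b).1 hb
        obtain ⟨j, hj⟩ := hhead R hR p hp (D.tr i).ext (i + 1) (hout i (by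
          rw [out_of_singleton_head (a := xAtom 𝓡 R) (by rw [hi]; rfl)]
          exact Finset.mem_singleton_self _))
        exact ⟨j, _, hj, rfl⟩
      · rw [hO i fun R hR e => hi ⟨R, hR, e⟩] at hb
        simp at hb
  have hargs : ∀ i (p : Atom) (σ : Subst), p.subst σ ∈ A i → ∀ v ∈ p.vars,
      ∃ u, applyTerm ρ u = σ v := by
    intro i p σ hp v hv
    obtain ⟨j, a, -, ha⟩ := hAS i _ hp
    have : σ v ∈ (p.subst σ).args := List.mem_map.2 ⟨_, Atom.mem_vars.1 hv, rfl⟩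
    rw [← ha] at this
    obtain ⟨u, -, hu⟩ := List.mem_map.1 this
    exact ⟨u, hu⟩
  refine not_ctall_of_chain hX A s (fun i => ?_) ?_ (fun i t ht hon => ?_) h
  · by_cases hOA : O i ⊆ A i
    · exact Or.inl (by rw [hAs, Finset.union_eq_left.2 hOA])
    right
    have hi : ∃ R ∈ 𝓡, (D.tr i).rule = xRule 𝓡 R := by
      by_contra hn
      rw [hO i fun R hR e => hn ⟨R, hR, e⟩] at hOA
      exact hOA (Finset.empty_subset _)
    obtain ⟨R, hR, hi⟩ := hi
    obtain ⟨hs, hOi⟩ := hOs i R hR hi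
    have hsr : (s i).rule = R := by rw [hs]; rfl
    have hsm : ∀ v, (s i).map v = applyTerm ρ ((D.tr i).map v) := fun v => by rw [hs]; rfl
    refine ⟨by rw [hAs, hOi], hsr ▸ hR, ?_, ?_⟩
    · intro p hp
      rw [hsr, Finset.mem_coe] at hp
      rw [hs, show p.subst ((D.tr i).transfer R ρ).map = (p.subst (D.tr i).map).subst ρ from
        (Atom.subst_subst _ _ _).symm]
      refine (hinv i _ (D.trig_on i (hlt i) p ?_)).1 (nonFresh_of_mem hR (Or.inl hp) _)
      rw [hi]
      exact Finset.mem_coe.2 hp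
    · by_contra hna
      obtain ⟨t', hk, ho⟩ := (not_applicable_iff hX).1 hna
      refine hOA ?_
      rw [hOi]
      refine subset_trans (Eq.subset ?_) ho
      have ht'r : t'.rule = R := hk.1.trans hsr
      by_cases hz : R.exVars.Nonempty
      · obtain ⟨z, hz⟩ := hz
        obtain ⟨p, hp, hzp⟩ := FactBase.mem_vars.1 (Finset.mem_sdiff.1 hz).1
        obtain ⟨u, hu⟩ := hargs i p t'.ext
          (ho (mem_out.2 ⟨p, by rwa [ht'r], rfl⟩)) z hzp
        rw [Trigger.ext, if_pos (by rwa [ht'r]), freshVar_eq, ht'r] at hu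
        cases u with
        | const c => simp [applyTerm] at hu
        | var v =>
          rw [hρdef] at hu
          have hv : rename 𝓡 pres J v = freshCode R t'.bodyVals z := Term.var.inj hu
          rcases rename_cases 𝓡 pres J v with ⟨S, l, y, ⟨hS, t0, ht0, hl⟩, -, hr⟩ | hr
          · obtain ⟨rfl, hl', -⟩ := freshCode_inj (hr.symm.trans hv)
            rw [← hρdef, ← hl] at hl'
            have hrr : (rep t0).rule = xRule 𝓡 S := (hrepk t0).1.trans ht0
            rw [← transfer_bodyVals hrr] at hl'
            have hagree := (Trigger.bodyVals_eq_iff (congrArg Rule.body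
              (show ((rep t0).transfer S ρ).rule = t'.rule from ht'r.symm))).1 hl'
            have hkey : SameKey X (rep t0) (D.tr i) := by
              refine ⟨hrr.trans hi.symm, fun v hv => ?_⟩
              rw [hi, keyVars_xRule] at hv
              refine hρ ((hagree v (keyVars_subset_body X S hv)).trans ?_)
              rw [hk.2 v (by rwa [hsr]), hsm]
            have hrep0 : rep t0 = D.tr i := by
              rw [← hrep _ _ (hrepk t0), hrep _ _ hkey, hreptr]
            refine Trigger.out_eq_of_bodyVals hk.1.symm ?_
            rw [hs, ← hl', hrep0]
          · exact absurd (freshCode_inj (hr.symm.trans hv)).1 (by rintro rfl; exact hJ hR)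
      · have hz' : R.exVars = ∅ := Finset.not_nonempty_iff_eq_empty.1 hz
        refine Trigger.out_congr hk.1.symm fun v hv => ?_
        rw [hsr] at hv
        rw [Trigger.ext_of_not_exVars (by simp [hsr, hz']),
          Trigger.ext_of_not_exVars (by simp [ht'r, hz'])]
        refine (hk.2 v ?_).symm
        rw [hsr]
        refine frontier_subset_keyVars X R (Finset.mem_inter.2 ⟨?_, hv⟩)
        by_contra hb
        exact hz ⟨v, Finset.mem_sdiff.2 ⟨hv, hb⟩⟩
  · by_contra hcon
    push Not at hcon
    obtain ⟨n, hn⟩ := hcon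
    have hstat : ∀ j, A j ⊆ A n := by
      intro j
      rcases le_total j n with hj | hj
      · exact hAmono hj
      · induction j, hj using Nat.le_induction with
        | base => exact subset_rfl
        | succ j hj ih => rw [hn j hj]; exact ih
    have hT := (F.finite_toSet.union (((A n).finite_toSet.preimage
      hρA.injOn).union (finite_xAtom_instances 𝓡 (A n) hρ)))
    have hle : ∀ j, D.fb j ⊆ hT.toFinset := by
      intro j a ha
      rw [Set.Finite.mem_toFinset]
      obtain ⟨i1, i2, i3 | i3 | ⟨R, hR, σ, e⟩⟩ := hinv j a ha
      · exact Or.inl i3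
      · exact Or.inr (Or.inl (hstat j (i1 i3)))
      · exact Or.inr (Or.inr ⟨R, hR, σ, e, fun p hp => hstat j (i2 R hR σ e p hp)⟩)
    have hcard : ∀ j, j ≤ (D.fb j).card := by
      intro j
      induction j with
      | zero => exact Nat.zero_le _
      | succ j ih =>
        refine Nat.succ_le_of_lt (ih.trans_lt (Finset.card_lt_card ?_))
        exact (hmono (Nat.le_succ j)).lt_of_not_ge fun hc =>
          D.trig_new j (hlt j) ((hout j).trans hc)
    have := (hcard (hT.toFinset.card + 1)).trans (Finset.card_le_card (hle _))
    omega
  · obtain ⟨j, hj⟩ := exists_uniform_index t.rule.body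
      (P := fun p j => ∃ a ∈ D.fb j, a.subst ρ = p.subst t.map)
      (fun p i j hij ⟨a, ha, e⟩ => ⟨a, hmono hij ha, e⟩) fun p hp => hAS i _ (hon p hp)
    have hpre : ∀ v ∈ FactBase.vars t.rule.body, ∃ u, applyTerm ρ u = t.map v := by
      intro v hv
      obtain ⟨p, hp, hv⟩ := FactBase.mem_vars.1 hv
      exact hargs i p t.map (hon p hp) v hv
    have : Nonempty Term := ⟨.const 0⟩
    choose! π hπ using hpre
    obtain ⟨k, t1, hk1, ho1⟩ := hevt j ⟨xRule 𝓡 t.rule, π⟩ (h1 (xRule_mem_oneAd ht)) (by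
      intro p hp
      obtain ⟨a, ha, e⟩ := hj p hp
      suffices p.subst π = a by rw [this]; exact ha
      refine hρA ?_
      rw [e, Atom.subst_subst]
      exact Atom.subst_eq_iff.2 fun v hv => hπ v (FactBase.mem_vars.2 ⟨p, hp, hv⟩))
    obtain ⟨m, hm⟩ := hrepg _ _ hk1 ⟨k, ho1⟩
    have hrk := hrepk ⟨xRule 𝓡 t.rule, π⟩
    have hrr : (rep ⟨xRule 𝓡 t.rule, π⟩).rule = xRule 𝓡 t.rule := hrk.1
    refine ⟨m, (not_applicable_iff hX).2
      ⟨(rep ⟨xRule 𝓡 t.rule, π⟩).transfer t.rule ρ, ⟨rfl, fun v hv => ?_⟩, fun b hb => ?_⟩⟩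
    · rw [← hπ v (keyVars_subset_body X _ hv)]
      exact congrArg (applyTerm ρ) (hrk.2 v (by rwa [keyVars_xRule]))
    · rw [hρdef, mem_transfer_out hrr ⟨ht, _, rfl, rfl⟩, ← hρdef] at hb
      obtain ⟨p, hp, rfl⟩ := hb
      refine (hinv m _ (hm ?_)).2.1 t.rule ht _ rfl p hp
      rw [out_of_singleton_head (a := xAtom 𝓡 t.rule) (by rw [hrr]; rfl)]
      exact Finset.mem_singleton_self _

/-- Both atomic decompositions preserve termination of the
oblivious and semi-oblivious chase. -/
theorem statement12 (X : Variant) (hX : X = Variant.O ∨ X = Variant.SO)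
    (𝓡 : RuleSet) (h : CTall X 𝓡) :
    CTall X (oneAd 𝓡) ∧ CTall X (twoAd 𝓡) := by
  exact ⟨ctall_of_oneAd_subset_of_subset_twoAd hX h subset_rfl Finset.subset_union_left,
    ctall_of_oneAd_subset_of_subset_twoAd hX h Finset.subset_union_left subset_rfl⟩

end
end ExRules
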